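/- arXiv:1808.03172 — 2 statements merged into one kernel-verified Lean document; each statement's English description precedes it below -/
import Mathlib

section
/- Let k be a field with char k ≠ 2 and let a, b ∈ k be nonzero. Then either every nonzero element of the quaternion algebra Q(a,b)_k is invertible (Q(a,b)_k is a 4-dimensional k-division algebra), or Q(a,b)_k is isomorphic as a k-algebra to the matrix algebra Mat₂(k). -/
open Quaternion

namespace QuaternionAlgebra

variable {k : Type*} [Field k] {a b : k}

theorem isUnit_of_norm_ne_zero {x : ℍ[k,a,b]}
    (hx : x.re ^ 2 - a * x.imI ^ 2 - b * (x.imJ ^ 2 - a * x.imK ^ 2) ≠ 0) : IsUnit x := by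
  generalize hn : x.re ^ 2 - a * x.imI ^ 2 - b * (x.imJ ^ 2 - a * x.imK ^ 2) = n at hx
  have hxs : x * star x = (n : ℍ[k,a,b]) := by ext <;> simp <;> grind
  have hsx : star x * x = (n : ℍ[k,a,b]) := by ext <;> simp <;> grind
  refine ⟨⟨x, n⁻¹ • star x, ?_, ?_⟩, rfl⟩
  · rw [mul_smul_comm, hxs, smul_coe, inv_mul_cancel₀ hx, coe_one]
  · rw [smul_mul_assoc, hsx, smul_coe, inv_mul_cancel₀ hx, coe_one]

theorem nonempty_algEquiv_matrix_of_injective (f : ℍ[k,a,b] →ₐ[k] Matrix (Fin 2) (Fin 2) k)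
    (hf : ∀ x, f x = 0 → x = 0) : Nonempty (ℍ[k,a,b] ≃ₐ[k] Matrix (Fin 2) (Fin 2) k) := by
  have hinj : Function.Injective f := (injective_iff_map_eq_zero f).2 hf
  have hrank : Module.finrank k ℍ[k,a,b] = Module.finrank k (Matrix (Fin 2) (Fin 2) k) := by
    simp [finrank_eq_four, Module.finrank_matrix]
  exact ⟨AlgEquiv.ofBijective f
    ⟨hinj, (LinearMap.injective_iff_surjective_of_finrank_eq_finrank (f := f.toLinearMap)
      hrank).1 hinj⟩⟩

theorem nonempty_algEquiv_matrix_of_isSquare (h2 : (2 : k) ≠ 0) (ha : a ≠ 0) (hb : b ≠ 0)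
    (hsq : IsSquare a) : Nonempty (ℍ[k,a,b] ≃ₐ[k] Matrix (Fin 2) (Fin 2) k) := by
  obtain ⟨c, rfl⟩ := hsq
  have hc : c ≠ 0 := left_ne_zero_of_mul ha
  let q : Basis (Matrix (Fin 2) (Fin 2) k) (c * c) 0 b :=
    { i := !![c, 0; 0, -c]
      j := !![0, b; 1, 0]
      k := !![0, c * b; -c, 0]
      i_mul_i := by simp [Matrix.one_fin_two]
      j_mul_j := by simp [Matrix.one_fin_two]
      i_mul_j := by simp
      j_mul_i := by simp [mul_comm] }
  refine nonempty_algEquiv_matrix_of_injective q.liftHom fun x hx ↦ ?_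
  have h (i j) := congrFun₂ hx i j
  have h00 : x.re + x.imI * c = 0 := by
    simpa [q, Basis.lift, Matrix.algebraMap_matrix_apply] using h 0 0
  have h01 : x.imJ * b + x.imK * (c * b) = 0 := by
    simpa [q, Basis.lift, Matrix.algebraMap_matrix_apply] using h 0 1
  have h10 : x.imJ + -(x.imK * c) = 0 := by
    simpa [q, Basis.lift, Matrix.algebraMap_matrix_apply] using h 1 0
  have h11 : x.re + -(x.imI * c) = 0 := by
    simpa [q, Basis.lift, Matrix.algebraMap_matrix_apply] using h 1 1
  ext
  · exact (mul_eq_zero_iff_left h2).1 (by linear_combination h00 + h11)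
  · exact (mul_eq_zero_iff_left (mul_ne_zero h2 hc)).1 (by linear_combination h00 - h11)
  · exact (mul_eq_zero_iff_left (mul_ne_zero h2 hb)).1 (by linear_combination h01 + b * h10)
  · exact (mul_eq_zero_iff_left (mul_ne_zero (mul_ne_zero h2 hc) hb)).1
      (by linear_combination h01 - b * h10)

theorem nonempty_algEquiv_matrix_of_eq_sq_sub (h2 : (2 : k) ≠ 0) (ha : a ≠ 0) (hb : b ≠ 0)
    {u v : k} (huv : u ^ 2 - a * v ^ 2 = b) :
    Nonempty (ℍ[k,a,b] ≃ₐ[k] Matrix (Fin 2) (Fin 2) k) := by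
  let q : Basis (Matrix (Fin 2) (Fin 2) k) a 0 b :=
    { i := !![0, a; 1, 0]
      j := !![u, -(a * v); v, -u]
      k := !![a * v, -(a * u); u, -(a * v)]
      i_mul_i := by simp [Matrix.one_fin_two]
      j_mul_j := by
        subst huv
        ext i j
        fin_cases i <;> fin_cases j <;> simp <;> ring
      i_mul_j := by simp
      j_mul_i := by simp [mul_comm] }
  refine nonempty_algEquiv_matrix_of_injective q.liftHom fun x hx ↦ ?_
  have h (i j) := congrFun₂ hx i j
  have h00 : x.re + x.imJ * u + x.imK * (a * v) = 0 := by
    simpa [q, Basis.lift, Matrix.algebraMap_matrix_apply] using h 0 0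
  have h01 : x.imI * a + -(x.imJ * (a * v)) + -(x.imK * (a * u)) = 0 := by
    simpa [q, Basis.lift, Matrix.algebraMap_matrix_apply] using h 0 1
  have h10 : x.imI + x.imJ * v + x.imK * u = 0 := by
    simpa [q, Basis.lift, Matrix.algebraMap_matrix_apply] using h 1 0
  have h11 : x.re + -(x.imJ * u) + -(x.imK * (a * v)) = 0 := by
    simpa [q, Basis.lift, Matrix.algebraMap_matrix_apply] using h 1 1
  have hre : x.re = 0 := (mul_eq_zero_iff_left h2).1 (by linear_combination h00 + h11)
  have hI : x.imI = 0 :=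
    (mul_eq_zero_iff_left (mul_ne_zero h2 ha)).1 (by linear_combination h01 + a * h10)
  ext
  · exact hre
  · exact hI
  · exact (mul_eq_zero_iff_left hb).1
      (by linear_combination u * (h00 - hre) - a * v * (h10 - hI) - x.imJ * huv)
  · exact (mul_eq_zero_iff_left hb).1
      (by linear_combination u * (h10 - hI) - v * (h00 - hre) - x.imK * huv)

end QuaternionAlgebra

theorem eq_zero_of_sq_sub_mul_sq_eq_zero {k : Type*} [Field k] {a : k} (ha : ¬IsSquare a)
    {s t : k} (h : s ^ 2 - a * t ^ 2 = 0) : s = 0 ∧ t = 0 := by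
  have ht : t = 0 := by
    by_contra ht
    refine ha ⟨s / t, ?_⟩
    field_simp
    linear_combination -h
  subst ht
  exact ⟨by simpa using h, rfl⟩

/-- For `char k ≠ 2` and nonzero `a b : k`, the quaternion algebra `Q(a,b)_k` is either a
division algebra or isomorphic to the algebra of 2×2 matrices over `k`. -/
theorem stmt_7 (k : Type*) [Field k] (hchar : (2 : k) ≠ 0)
    (a b : k) (ha : a ≠ 0) (hb : b ≠ 0) :
    (∀ x : ℍ[k,a,b], x ≠ 0 → IsUnit x) ∨
      Nonempty (ℍ[k,a,b] ≃ₐ[k] Matrix (Fin 2) (Fin 2) k) := by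
  by_cases hsq : IsSquare a
  · exact .inr (QuaternionAlgebra.nonempty_algEquiv_matrix_of_isSquare hchar ha hb hsq)
  refine or_iff_not_imp_left.2 fun hdiv ↦ ?_
  push Not at hdiv
  obtain ⟨x, hx0, hx⟩ := hdiv
  have hN : x.re ^ 2 - a * x.imI ^ 2 - b * (x.imJ ^ 2 - a * x.imK ^ 2) = 0 :=
    not_not.1 (mt QuaternionAlgebra.isUnit_of_norm_ne_zero hx)
  have hD : x.imJ ^ 2 - a * x.imK ^ 2 ≠ 0 := by
    intro hD
    obtain ⟨hJ, hK⟩ := eq_zero_of_sq_sub_mul_sq_eq_zero hsq hD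
    obtain ⟨hre, hI⟩ := eq_zero_of_sq_sub_mul_sq_eq_zero (s := x.re) (t := x.imI) hsq
      (by linear_combination hN + b * hD)
    exact hx0 (QuaternionAlgebra.ext hre hI hJ hK)
  refine QuaternionAlgebra.nonempty_algEquiv_matrix_of_eq_sq_sub hchar ha hb
    (u := (x.re * x.imJ - a * x.imI * x.imK) / (x.imJ ^ 2 - a * x.imK ^ 2))
    (v := (x.imI * x.imJ - x.re * x.imK) / (x.imJ ^ 2 - a * x.imK ^ 2)) ?_
  field_simp
  linear_combination (x.imJ ^ 2 - a * x.imK ^ 2) * hN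
end

section
/- Let k be a field and q ∈ k a nonzero scalar. In the q-polynomial algebra k_q[x,y] = k⟨x,y⟩/(yx − q·xy), the family of monomials {x^i y^j : i, j ≥ 0} (images of the corresponding words in the free algebra) is a k-vector space basis of k_q[x,y]. -/
/-- The defining relation of the q-polynomial algebra: `y * x = q • (x * y)`. -/
inductive QPolyRel (k : Type*) [CommRing k] (q : k) :
    FreeAlgebra k (Fin 2) → FreeAlgebra k (Fin 2) → Prop
  | rel : QPolyRel k q (FreeAlgebra.ι k 1 * FreeAlgebra.ι k 0)
      (q • (FreeAlgebra.ι k 0 * FreeAlgebra.ι k 1))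

/-- The q-polynomial algebra `k_q[x,y] = k⟨x,y⟩/(yx − q·xy)`. -/
abbrev QPoly (k : Type*) [CommRing k] (q : k) := RingQuot (QPolyRel k q)

namespace QPoly

variable {k : Type*} [CommRing k] (q : k)

/-- The image of `x` in `k_q[x,y]`. -/
noncomputable def x : QPoly k q := RingQuot.mkAlgHom k (QPolyRel k q) (FreeAlgebra.ι k 0)

/-- The image of `y` in `k_q[x,y]`. -/
noncomputable def y : QPoly k q := RingQuot.mkAlgHom k (QPolyRel k q) (FreeAlgebra.ι k 1)

theorem y_mul_x : y q * x q = q • (x q * y q) := by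
  simpa only [map_mul, map_smul, x, y] using RingQuot.mkAlgHom_rel k (QPolyRel.rel (k := k) (q := q))

theorem y_mul_x_pow (i : ℕ) : y q * x q ^ i = q ^ i • (x q ^ i * y q) := by
  induction i with
  | zero => simp
  | succ i ih =>
    rw [pow_succ, ← mul_assoc, ih, smul_mul_assoc, mul_assoc, y_mul_x, mul_smul_comm, smul_smul,
      ← pow_succ, mul_assoc]

/-- The span of the monomials `x ^ i * y ^ j`. -/
noncomputable def monomialSpan : Submodule k (QPoly k q) :=
  Submodule.span k (Set.range fun p : ℕ × ℕ => x q ^ p.1 * y q ^ p.2)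

theorem monomial_mem_monomialSpan (i j : ℕ) : x q ^ i * y q ^ j ∈ monomialSpan q :=
  Submodule.subset_span ⟨(i, j), rfl⟩

/-- If left multiplication by `a` sends monomials into the span of the monomials, then it
preserves that span. -/
theorem mul_mem_monomialSpan {a : QPoly k q}
    (h : ∀ i j : ℕ, a * (x q ^ i * y q ^ j) ∈ monomialSpan q) {s : QPoly k q}
    (hs : s ∈ monomialSpan q) : a * s ∈ monomialSpan q := by
  have hle : monomialSpan q ≤ (monomialSpan q).comap (LinearMap.mulLeft k a) := by
    refine Submodule.span_le.2 ?_
    rintro _ ⟨p, rfl⟩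
    exact h p.1 p.2
  exact hle hs

theorem mkAlgHom_mul_mem_monomialSpan (a : FreeAlgebra k (Fin 2)) :
    ∀ s ∈ monomialSpan q, RingQuot.mkAlgHom k (QPolyRel k q) a * s ∈ monomialSpan q := by
  induction a using FreeAlgebra.induction with
  | grade0 r =>
    intro s hs
    rw [AlgHom.commutes, ← Algebra.smul_def]
    exact Submodule.smul_mem _ r hs
  | grade1 v =>
    intro s hs
    refine mul_mem_monomialSpan q (fun i j => ?_) hs
    fin_cases v
    · change x q * (x q ^ i * y q ^ j) ∈ _
      rw [← mul_assoc, ← pow_succ']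
      exact monomial_mem_monomialSpan q (i + 1) j
    · change y q * (x q ^ i * y q ^ j) ∈ _
      rw [← mul_assoc, y_mul_x_pow, smul_mul_assoc, mul_assoc, ← pow_succ']
      exact Submodule.smul_mem _ _ (monomial_mem_monomialSpan q i (j + 1))
  | mul a b ha hb =>
    intro s hs
    rw [map_mul, mul_assoc]
    exact ha _ (hb _ hs)
  | add a b ha hb =>
    intro s hs
    rw [map_add, add_mul]
    exact Submodule.add_mem _ (ha _ hs) (hb _ hs)

theorem monomialSpan_eq_top : monomialSpan q = ⊤ := by
  refine Submodule.eq_top_iff'.2 fun s => ?_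
  obtain ⟨a, rfl⟩ := RingQuot.mkAlgHom_surjective k (QPolyRel k q) s
  have h_one : (1 : QPoly k q) ∈ monomialSpan q := by
    simpa using monomial_mem_monomialSpan q 0 0
  simpa using mkAlgHom_mul_mem_monomialSpan q a 1 h_one

/-- The operator by which `x` acts on formal monomials: `(i, j) ↦ (i + 1, j)`. -/
noncomputable def xOp (k : Type*) [CommRing k] : Module.End k (ℕ × ℕ →₀ k) :=
  Finsupp.linearCombination k fun p => Finsupp.single (p.1 + 1, p.2) 1

/-- The operator by which `y` acts on formal monomials: `(i, j) ↦ q ^ i • (i, j + 1)`. -/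
noncomputable def yOp : Module.End k (ℕ × ℕ →₀ k) :=
  Finsupp.linearCombination k fun p => Finsupp.single (p.1, p.2 + 1) (q ^ p.1)

theorem xOp_single (i j : ℕ) (c : k) :
    xOp k (Finsupp.single (i, j) c) = Finsupp.single (i + 1, j) c := by
  simp [xOp]

theorem yOp_single (i j : ℕ) (c : k) :
    yOp q (Finsupp.single (i, j) c) = Finsupp.single (i, j + 1) (c * q ^ i) := by
  simp [yOp]

theorem yOp_mul_xOp : yOp q * xOp k = q • (xOp k * yOp q) := by
  refine Finsupp.lhom_ext fun p c => ?_
  obtain ⟨i, j⟩ := p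
  simp only [Module.End.mul_apply, LinearMap.smul_apply, xOp_single, yOp_single,
    Finsupp.smul_single, smul_eq_mul]
  congr 1
  ring

theorem xOp_pow_yOp_pow_single (i j : ℕ) :
    (xOp k ^ i * yOp q ^ j) (Finsupp.single (0, 0) 1) = Finsupp.single (i, j) 1 := by
  have hy : (yOp q ^ j) (Finsupp.single (0, 0) 1) = Finsupp.single (0, j) 1 := by
    induction j with
    | zero => simp
    | succ j ih => rw [pow_succ', Module.End.mul_apply, ih, yOp_single, pow_zero, mul_one]
  rw [Module.End.mul_apply, hy]
  induction i with
  | zero => simp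
  | succ i ih => rw [pow_succ', Module.End.mul_apply, ih, xOp_single]

/-- The action of `k_q[x,y]` on the free module on the formal monomials. -/
noncomputable def toEnd : QPoly k q →ₐ[k] Module.End k (ℕ × ℕ →₀ k) :=
  RingQuot.liftAlgHom k ⟨FreeAlgebra.lift k ![xOp k, yOp q], by
    rintro _ _ ⟨⟩
    simpa using yOp_mul_xOp q⟩

theorem toEnd_x : toEnd q (x q) = xOp k := by
  simp [toEnd, x]

theorem toEnd_y : toEnd q (y q) = yOp q := by
  simp [toEnd, y]

theorem linearIndependent_monomials :
    LinearIndependent k fun p : ℕ × ℕ => x q ^ p.1 * y q ^ p.2 := by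
  refine LinearIndependent.of_comp
    ((LinearMap.applyₗ (Finsupp.single (0, 0) 1)).comp (toEnd q).toLinearMap) ?_
  convert (Finsupp.basisSingleOne (R := k) (ι := ℕ × ℕ)).linearIndependent using 1
  ext1 p
  simp [toEnd_x, toEnd_y, xOp_pow_yOp_pow_single,
    -Module.End.mul_apply]

end QPoly

/-- The monomials `x^i y^j` form a `k`-vector space basis of `k_q[x,y]`. -/
theorem stmt_12 (k : Type*) [Field k] (q : k) (hq : q ≠ 0) :
    LinearIndependent k (fun p : ℕ × ℕ => (RingQuot.mkAlgHom k (QPolyRel k q)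
        (FreeAlgebra.ι k 0 ^ p.1 * FreeAlgebra.ι k 1 ^ p.2) : QPoly k q)) ∧
      Submodule.span k (Set.range (fun p : ℕ × ℕ => (RingQuot.mkAlgHom k (QPolyRel k q)
        (FreeAlgebra.ι k 0 ^ p.1 * FreeAlgebra.ι k 1 ^ p.2) : QPoly k q))) = ⊤ := by
  simp only [map_mul, map_pow]
  exact ⟨QPoly.linearIndependent_monomials q, QPoly.monomialSpan_eq_top q⟩
end
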